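/- Let G be a finite group acting faithfully on a finite type N and acting on a finite type O. Consider single-hidden-layer G-equivariant networks of the form ψ̂(x)(o) = Σ_{c=1}^{C} Σ_{h ∈ G} Φ'_c(o, h) · ReLU( (Σ_{i ∈ N} Φ_c(h, i) · x(i)) + b_c ), where the hidden layer is indexed by G itself carrying the right regular action g • h = h g⁻¹, and the weights satisfy the parameter-sharing constraints Φ_c(g • h, g • i) = Φ_c(h, i) and Φ'_c(g • o, g • h) = Φ'_c(o, h) for all g ∈ G. Then for every continuous G-equivariant function ψ : (N → ℝ) → (O → ℝ), every compact set K ⊆ (N → ℝ), and every ε > 0, there exist C ∈ ℕ, weights Φ_c, Φ'_c satisfying the constraints, and scalars b_c ∈ ℝ such that max_{o ∈ O} |ψ(x)(o) − ψ̂(x)(o)| ≤ ε for all x ∈ K. -/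

import Mathlib

/-- A linear space of functions `ℝ → ℝ` containing all `t ↦ ReLU (s * t + b)` approximates
uniformly continuous functions uniformly on compact intervals. -/
lemma UniformContinuous.exists_mem_near_of_relu_mem (S : Submodule ℝ (ℝ → ℝ))
    (hS : ∀ s b : ℝ, (fun t => max 0 (s * t + b)) ∈ S) {f : ℝ → ℝ} (hf : UniformContinuous f)
    (a b : ℝ) {ε : ℝ} (hε : 0 < ε) :
    ∃ g ∈ S, ∀ t ∈ Set.Icc a b, |g t - f t| ≤ ε := by
  obtain ⟨δ', hδ', hfδ'⟩ := Metric.uniformContinuous_iff.1 hf ε hε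
  obtain ⟨δ, hδ, hδδ'⟩ := exists_between hδ'
  have hfδ : ∀ x y : ℝ, |x - y| ≤ δ → |f x - f y| ≤ ε := fun x y h =>
    (hfδ' (by rw [Real.dist_eq]; linarith)).le
  have key : ∀ n : ℕ, ∃ g ∈ S, (∀ t ∈ Set.Icc a (a + n * δ), |g t - f t| ≤ ε) ∧
      ∀ t, a + n * δ ≤ t → g t = f (a + n * δ) := by
    intro n
    induction n with
    | zero =>
      refine ⟨fun _ => f a, ?_, ?_, ?_⟩
      · have h := S.smul_mem (f a) (hS 0 1)
        convert h using 1
        ext t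
        simp
      · intro t ht
        have : t = a := le_antisymm (by simpa using ht.2) ht.1
        simp [this, hε.le]
      · intro t _
        simp
    | succ n ih =>
      obtain ⟨g, hg, hgf, hgc⟩ := ih
      have hstep : a + ((n + 1 : ℕ) : ℝ) * δ = a + n * δ + δ := by push_cast; ring
      rw [hstep]
      set p := a + n * δ with hp
      refine ⟨g + (f (p + δ) - f p) • ((fun t => max 0 (δ⁻¹ * t + -(δ⁻¹ * p))) -
        fun t => max 0 (δ⁻¹ * t + -(δ⁻¹ * p + 1))),
        S.add_mem hg (S.smul_mem _ (S.sub_mem (hS _ _) (hS _ _))), ?_, ?_⟩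
      · intro t ht
        simp only [Pi.add_apply, Pi.smul_apply, Pi.sub_apply, smul_eq_mul]
        obtain ⟨θ, hθ⟩ : ∃ θ, θ = δ⁻¹ * (t - p) := ⟨_, rfl⟩
        have h1 : δ⁻¹ * t + -(δ⁻¹ * p) = θ := by rw [hθ]; ring
        have h2 : δ⁻¹ * t + -(δ⁻¹ * p + 1) = θ - 1 := by rw [hθ]; ring
        have htθ : t - p = δ * θ := by rw [hθ]; field_simp
        rw [h1, h2]
        rcases le_total t p with htp | htp
        · have h0 : θ ≤ 0 := by
            by_contra! h
            nlinarith [mul_pos hδ h]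
          rw [max_eq_left h0, max_eq_left (by linarith)]
          simpa using hgf t ⟨ht.1, htp⟩
        · have h0 : 0 ≤ θ := by
            rw [hθ]
            exact mul_nonneg (inv_nonneg.2 hδ.le) (by linarith)
          have h1 : θ ≤ 1 := by
            by_contra! h
            nlinarith [mul_lt_mul_of_pos_left h hδ, ht.2]
          rw [max_eq_right h0, max_eq_left (by linarith), hgc t htp]
          have e1 := abs_le.1 (hfδ p t (abs_le.2 ⟨by linarith [ht.2], by linarith⟩))
          have e2 := abs_le.1 (hfδ (p + δ) t (abs_le.2 ⟨by linarith [ht.2], by linarith⟩))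
          rw [abs_le]
          constructor <;> nlinarith
      · intro t ht
        simp only [Pi.add_apply, Pi.smul_apply, Pi.sub_apply, smul_eq_mul]
        have h1 : 1 ≤ δ⁻¹ * (t - p) := by
          rw [inv_mul_eq_div, le_div_iff₀ hδ]
          linarith
        rw [hgc t (by linarith), max_eq_right (by linarith), max_eq_right (by linarith)]
        ring
  obtain ⟨n, hn⟩ := exists_nat_ge ((b - a) / δ)
  obtain ⟨g, hg, hgf, -⟩ := key n
  refine ⟨g, hg, fun t ht => hgf t ⟨ht.1, ?_⟩⟩
  rw [div_le_iff₀ hδ] at hn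
  linarith [ht.2]

/-- A linear space of functions `ℝ → ℝ` containing all `t ↦ ReLU (s * t + b)` approximates
continuous functions uniformly on compact intervals. -/
lemma Continuous.exists_mem_near_of_relu_mem (S : Submodule ℝ (ℝ → ℝ))
    (hS : ∀ s b : ℝ, (fun t => max 0 (s * t + b)) ∈ S) {f : ℝ → ℝ} (hf : Continuous f)
    {a b : ℝ} (hab : a ≤ b) {ε : ℝ} (hε : 0 < ε) :
    ∃ g ∈ S, ∀ t ∈ Set.Icc a b, |g t - f t| ≤ ε := by
  have hu : UniformContinuous (Set.IccExtend hab fun t : Set.Icc a b => f t) :=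
    (CompactSpace.uniformContinuous_of_continuous (hf.comp continuous_subtype_val)).comp
      (LipschitzWith.projIcc hab).uniformContinuous
  obtain ⟨g, hg, h⟩ := hu.exists_mem_near_of_relu_mem S hS a b hε
  refine ⟨g, hg, fun t ht => ?_⟩
  simpa [Set.IccExtend_of_mem hab _ ht] using h t ht

/-- Real-valued single-hidden-layer ReLU networks on `N → ℝ`. -/
def reluSpan (N : Type*) [Fintype N] : Submodule ℝ ((N → ℝ) → ℝ) :=
  Submodule.span ℝ (Set.range fun p : (N → ℝ) × ℝ => fun x => max 0 ((∑ i, p.1 i * x i) + p.2))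

lemma relu_mem_reluSpan {N : Type*} [Fintype N] (w : N → ℝ) (b : ℝ) :
    (fun x : N → ℝ => max 0 ((∑ i, w i * x i) + b)) ∈ reluSpan N :=
  Submodule.subset_span ⟨(w, b), rfl⟩

/-- The continuous function `x ↦ exp (∑ i, w i * x i)`. -/
noncomputable def expRidge {N : Type*} [Fintype N] (w : N → ℝ) : C(N → ℝ, ℝ) :=
  ⟨fun x => Real.exp (∑ i, w i * x i), by fun_prop⟩

lemma exists_mem_reluSpan_near_expRidge {N : Type*} [Fintype N] (w : N → ℝ)
    {K : Set (N → ℝ)} (hK : IsCompact K) {ε : ℝ} (hε : 0 < ε) :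
    ∃ g ∈ reluSpan N, ∀ x ∈ K, |g x - expRidge w x| ≤ ε := by
  have hc : Continuous fun x : N → ℝ => ∑ i, w i * x i := by fun_prop
  obtain ⟨R, hR⟩ := hK.exists_bound_of_continuousOn hc.continuousOn
  obtain ⟨g, hg, h⟩ := Real.continuous_exp.exists_mem_near_of_relu_mem
    ((reluSpan N).comap (LinearMap.funLeft ℝ ℝ fun x : N → ℝ => ∑ i, w i * x i))
    (fun s b => by
      rw [Submodule.mem_comap]
      convert relu_mem_reluSpan (s • w) b using 1
      ext x
      simp [LinearMap.funLeft_apply, Finset.mul_sum, mul_assoc])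
    (a := -|R|) (b := |R|) (by linarith [abs_nonneg R]) hε
  exact ⟨_, hg, fun x hx => h _ (abs_le.1 ((hR x hx).trans (le_abs_self R)))⟩

lemma exists_eq_expRidge_of_mem_closure {N : Type*} [Fintype N] {f : C(N → ℝ, ℝ)}
    (hf : f ∈ Submonoid.closure (Set.range (expRidge (N := N)))) : ∃ w, f = expRidge w := by
  induction hf using Submonoid.closure_induction with
  | mem f hf => exact hf.imp fun _ h => h.symm
  | one => exact ⟨0, by ext x; simp [expRidge]⟩
  | mul f g _ _ hf hg =>
    obtain ⟨v, rfl⟩ := hf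
    obtain ⟨w, rfl⟩ := hg
    exact ⟨v + w, by
      ext x
      simp [expRidge, add_mul, Finset.sum_add_distrib, Real.exp_add]⟩

lemma separatesPoints_adjoin_expRidge (N : Type*) [Fintype N] :
    (Algebra.adjoin ℝ (Set.range (expRidge (N := N)))).SeparatesPoints := by
  classical
  intro x y hxy
  obtain ⟨i, hi⟩ := Function.ne_iff.1 hxy
  refine ⟨_, ⟨expRidge (Pi.single i 1), Algebra.subset_adjoin ⟨_, rfl⟩, rfl⟩, ?_⟩
  simpa [expRidge, Pi.single_apply] using hi

/-- Universal approximation by real-valued single-hidden-layer ReLU networks. -/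
lemma exists_mem_reluSpan_near {N : Type*} [Fintype N] {f : (N → ℝ) → ℝ} (hf : Continuous f)
    {K : Set (N → ℝ)} (hK : IsCompact K) {ε : ℝ} (hε : 0 < ε) :
    ∃ g ∈ reluSpan N, ∀ x ∈ K, |g x - f x| ≤ ε := by
  obtain ⟨p, hp, hpf⟩ :=
    ContinuousMap.exists_mem_subalgebra_near_continuous_of_isCompact_of_separatesPoints
      (separatesPoints_adjoin_expRidge N) ⟨f, hf⟩ hK (half_pos hε)
  have happ : ∀ δ > 0, ∃ g ∈ reluSpan N, ∀ x ∈ K, |g x - p x| ≤ δ := by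
    rw [← Subalgebra.mem_toSubmodule, Algebra.adjoin_eq_span] at hp
    clear hpf
    induction hp using Submodule.span_induction with
    | mem q hq =>
      obtain ⟨w, rfl⟩ := exists_eq_expRidge_of_mem_closure hq
      exact fun δ hδ => exists_mem_reluSpan_near_expRidge w hK hδ
    | zero => exact fun δ hδ => ⟨0, zero_mem _, fun x _ => by simpa using hδ.le⟩
    | add q r _ _ hq hr =>
      intro δ hδ
      obtain ⟨g, hg, hgq⟩ := hq _ (half_pos hδ)
      obtain ⟨h, hh, hhr⟩ := hr _ (half_pos hδ)
      refine ⟨g + h, add_mem hg hh, fun x hx => ?_⟩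
      calc |(g + h) x - (q + r) x| = |(g x - q x) + (h x - r x)| := by
            simp only [Pi.add_apply, ContinuousMap.add_apply]; congr 1; ring
        _ ≤ |g x - q x| + |h x - r x| := abs_add_le _ _
        _ ≤ δ := by linarith [hgq x hx, hhr x hx]
    | smul c q _ hq =>
      intro δ hδ
      have hc : 0 < |c| + 1 := by positivity
      obtain ⟨g, hg, hgq⟩ := hq _ (div_pos hδ hc)
      refine ⟨c • g, Submodule.smul_mem _ c hg, fun x hx => ?_⟩
      calc |(c • g) x - (c • q) x| = |c| * |g x - q x| := by
            simp [← mul_sub, abs_mul]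
        _ ≤ (|c| + 1) * (δ / (|c| + 1)) := by
            gcongr
            · linarith
            · exact hgq x hx
        _ = δ := by field_simp
  obtain ⟨g, hg, hgp⟩ := happ _ (half_pos hε)
  refine ⟨g, hg, fun x hx => ?_⟩
  have h2 : |p x - f x| < ε / 2 := hpf x hx
  linarith [abs_sub_le (g x) (p x) (f x), hgp x hx]

/-- Universal approximation by vector-valued single-hidden-layer ReLU networks. -/
lemma exists_relu_network_near {N O : Type*} [Fintype N] [Fintype O] {f : (N → ℝ) → O → ℝ}
    (hf : Continuous f) {K : Set (N → ℝ)} (hK : IsCompact K) {ε : ℝ} (hε : 0 < ε) :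
    ∃ (C : ℕ) (w : Fin C → N → ℝ) (a : Fin C → O → ℝ) (b : Fin C → ℝ),
      ∀ x ∈ K, ∀ o, |∑ c, a c o * max 0 ((∑ i, w c i * x i) + b c) - f x o| ≤ ε := by
  classical
  choose g hg hgf using fun o => exists_mem_reluSpan_near (continuous_pi_iff.1 hf o) hK hε
  choose n r q hq using fun o => Submodule.mem_span_set'.1 (hg o)
  choose p hp using fun o c => (q o c).2
  let e := Fintype.equivFin (Σ o, Fin (n o))
  refine ⟨_, fun c => (p (e.symm c).1 (e.symm c).2).1,
    fun c => Pi.single (e.symm c).1 (r (e.symm c).1 (e.symm c).2),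
    fun c => (p (e.symm c).1 (e.symm c).2).2, fun x hx o => ?_⟩
  convert hgf o x hx using 3
  rw [e.symm.sum_comp fun s => (Pi.single s.1 (r s.1 s.2) : O → ℝ) o *
    max 0 ((∑ i, (p s.1 s.2).1 i * x i) + (p s.1 s.2).2), Fintype.sum_sigma,
    Finset.sum_eq_single o, ← hq o]
  · simp [← hp]
  · intro o' _ ho'
    simp [Pi.single_eq_of_ne ho'.symm]
  · simp


/-- **Universality of equivariant MLPs with a regular hidden layer.**
Let `G` be a finite group acting faithfully on a finite type `N` and acting on a finite type
`O`.  Single-hidden-layer `G`-equivariant networks with a regular hidden layer indexed by `G`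
(right regular action `g • h = h * g⁻¹`) and parameter-sharing constraints
`Φ c (h * g⁻¹) (g • i) = Φ c h i` and `Φ' c (g • o) (h * g⁻¹) = Φ' c o h`
can approximate any continuous `G`-equivariant function uniformly on compact sets. -/
theorem equivariant_regular_universality
    {G : Type*} [Group G] [Fintype G] {N : Type*} [Fintype N] {O : Type*} [Fintype O]
    [MulAction G N] [FaithfulSMul G N] [MulAction G O]
    (ψ : (N → ℝ) → (O → ℝ)) (hcont : Continuous ψ)
    (hequiv : ∀ (g : G) (x : N → ℝ),
      ψ (fun i => x (g⁻¹ • i)) = fun o => ψ x (g⁻¹ • o))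
    (K : Set (N → ℝ)) (hK : IsCompact K) (ε : ℝ) (hε : 0 < ε) :
    ∃ (C : ℕ) (Φ : Fin C → G → N → ℝ) (Φ' : Fin C → O → G → ℝ) (b : Fin C → ℝ),
      (∀ (c : Fin C) (g h : G) (i : N), Φ c (h * g⁻¹) (g • i) = Φ c h i) ∧
      (∀ (c : Fin C) (g h : G) (o : O), Φ' c (g • o) (h * g⁻¹) = Φ' c o h) ∧
      ∀ x ∈ K, ∀ o : O,
        |ψ x o - ∑ c : Fin C, ∑ h : G,
            Φ' c o h * max 0 ((∑ i : N, Φ c h i * x i) + b c)| ≤ ε := by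
  let act : G → (N → ℝ) → N → ℝ := fun h x i => x (h⁻¹ • i)
  have hact : ∀ h, Continuous (act h) := fun h => by fun_prop
  have hcard : (0 : ℝ) < Fintype.card G := by exact_mod_cast Fintype.card_pos
  obtain ⟨C, w, a, b, hnet⟩ := exists_relu_network_near
    (hcont.const_smul (Fintype.card G : ℝ)⁻¹)
    (isCompact_iUnion fun h => hK.image (hact h)) (div_pos hε hcard)
  refine ⟨C, fun c h i => w c (h • i), fun c o h => a c (h • o), b, ?_, ?_, ?_⟩
  · intro c g h i
    simp [mul_smul]
  · intro c g h o
    simp [mul_smul]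
  · intro x hx o
    have hterm : ∀ h : G, |∑ c, a c (h • o) * max 0 ((∑ i, w c (h • i) * x i) + b c) -
        (Fintype.card G : ℝ)⁻¹ * ψ x o| ≤ ε / Fintype.card G := by
      intro h
      have key := hnet (act h x) (Set.mem_iUnion.2 ⟨h, x, hx, rfl⟩) (h • o)
      have hψ : ψ (act h x) (h • o) = ψ x o := by simp [act, hequiv]
      have hsum : ∀ c, ∑ i, w c i * act h x i = ∑ i, w c (h • i) * x i := fun c => by
        rw [← Equiv.sum_comp (MulAction.toPerm h)]
        simp [act]
      simpa only [Pi.smul_apply, smul_eq_mul, hψ, hsum] using key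
    rw [Finset.sum_comm, abs_sub_comm]
    calc _ = |∑ h : G, (∑ c, a c (h • o) * max 0 ((∑ i, w c (h • i) * x i) + b c) -
          (Fintype.card G : ℝ)⁻¹ * ψ x o)| := by
          rw [Finset.sum_sub_distrib, Finset.sum_const, Finset.card_univ, nsmul_eq_mul,
            mul_inv_cancel_left₀ hcard.ne']
      _ ≤ ∑ _h : G, ε / Fintype.card G :=
          (Finset.abs_sum_le_sum_abs _ _).trans (Finset.sum_le_sum fun h _ => hterm h)
      _ = ε := by
          rw [Finset.sum_const, Finset.card_univ, nsmul_eq_mul]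
          field_simp
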